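/- arXiv:1812.11945 — 2 statements merged into one kernel-verified Lean document; each statement's English description precedes it below -/
import Mathlib

section
/- Let q be a power of 3 and let ℓ, m ≥ 0 be integers. For n = 4·3^m and d = 2·3^ℓ, one has 𝒟_{n,d} = 2·x^{2·3^{ℓ+m}} + 2·x^{4·3^{ℓ+m}} in 𝔽_q[x]; in particular 𝒟_{n,d} is a Dembowski–Ostrom polynomial. -/
open Polynomial Finset

/-- A Dembowski–Ostrom polynomial in characteristic `p`: every exponent occurring with a
nonzero coefficient is of the form `p^i + p^j` for nonnegative integers `i, j`. -/
def IsDOPoly (p : ℕ) {F : Type*} [Field F] (f : F[X]) : Prop :=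
  ∀ k ∈ f.support, ∃ i j : ℕ, k = p ^ i + p ^ j

/-- The integer coefficient `(n/(n-i)) * binom(n-i, i)` of the reversed Dickson
polynomial of the first kind (the natural division is exact). -/
def dicksonCoeff (n i : ℕ) : ℕ := n * (n - i).choose i / (n - i)

/-- `𝒟_{n,d} = D_n(1, x^d) - D_n(1, 0)` over `F`, i.e.
`∑_{i=1}^{⌊n/2⌋} (n/(n-i))·binom(n-i,i)·(-1)^i·x^{d·i}`. -/
noncomputable def DD (F : Type*) [Field F] (n d : ℕ) : F[X] :=
  ∑ i ∈ Finset.Icc 1 (n / 2), C ((-1 : F) ^ i * (dicksonCoeff n i : F)) * X ^ (d * i)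

/-- `𝖤_{n,d} = E_n(1, x^d) - E_n(1, 0)` over `F`, i.e.
`∑_{i=1}^{⌊n/2⌋} binom(n-i,i)·(-1)^i·x^{d·i}`. -/
noncomputable def EE (F : Type*) [Field F] (n d : ℕ) : F[X] :=
  ∑ i ∈ Finset.Icc 1 (n / 2), C ((-1 : F) ^ i * ((n - i).choose i : F)) * X ^ (d * i)

/-- The reversed Dickson polynomial of the first kind `D_n(a, x)`, as a function on `F`. -/
def revDicksonFst {F : Type*} [Field F] (n : ℕ) (a x : F) : F :=
  ∑ i ∈ Finset.range (n / 2 + 1), (dicksonCoeff n i : F) * (-x) ^ i * a ^ (n - 2 * i)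

/-- The reversed Dickson polynomial of the second kind `E_n(a, x)`, as a function on `F`. -/
def revDicksonSnd {F : Type*} [Field F] (n : ℕ) (a x : F) : F :=
  ∑ i ∈ Finset.range (n / 2 + 1), ((n - i).choose i : F) * (-x) ^ i * a ^ (n - 2 * i)

/-- `D_n(1, x)` as a one-variable polynomial over `F`. -/
noncomputable def revDicksonFstPoly (F : Type*) [Field F] (n : ℕ) : F[X] :=
  ∑ i ∈ Finset.range (n / 2 + 1), C ((-1 : F) ^ i * (dicksonCoeff n i : F)) * X ^ i

theorem dicksonCoeff_zero {n : ℕ} (hn : n ≠ 0) : dicksonCoeff n 0 = 1 := by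
  simp [dicksonCoeff, Nat.div_self (Nat.pos_of_ne_zero hn)]

theorem dicksonCoeff_eq_zero {n i : ℕ} (h : n < 2 * i) : dicksonCoeff n i = 0 := by
  simp [dicksonCoeff, Nat.choose_eq_zero_of_lt (show n - i < i by omega)]

theorem dicksonCoeff_add_succ (j k : ℕ) :
    dicksonCoeff (k + 2 + j) (k + 1) = (j + 1).choose (k + 1) + j.choose k := by
  have hsub : k + 2 + j - (k + 1) = j + 1 := by omega
  rw [dicksonCoeff, hsub]
  apply Nat.div_eq_of_eq_mul_right j.succ_pos
  have h := Nat.add_one_mul_choose_eq j k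
  linarith

theorem dicksonCoeff_add_two {n : ℕ} (hn : n ≠ 0) (i : ℕ) :
    dicksonCoeff (n + 2) (i + 1) = dicksonCoeff (n + 1) (i + 1) + dicksonCoeff n i := by
  rcases lt_or_ge n (2 * i) with h | h
  · rw [dicksonCoeff_eq_zero (by omega), dicksonCoeff_eq_zero (by omega), dicksonCoeff_eq_zero h]
  rcases i with _ | k
  · obtain ⟨j, rfl⟩ := Nat.exists_eq_succ_of_ne_zero hn
    have h₁ := dicksonCoeff_add_succ (j + 1) 0
    have h₂ := dicksonCoeff_add_succ j 0
    rw [dicksonCoeff_zero hn, show j.succ + 2 = 0 + 2 + (j + 1) by omega,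
      show j.succ + 1 = 0 + 2 + j by omega, h₁, h₂]
    simp
  · obtain ⟨j, rfl⟩ := Nat.exists_eq_add_of_le (show k + 2 ≤ n by omega)
    have h₁ := dicksonCoeff_add_succ (j + 1) (k + 1)
    have h₂ := dicksonCoeff_add_succ j (k + 1)
    rw [show k + 2 + j + 2 = k + 1 + 2 + (j + 1) by omega,
      show k + 2 + j + 1 = k + 1 + 2 + j by omega, h₁, h₂, dicksonCoeff_add_succ]
    have h₃ := Nat.choose_succ_succ (j + 1) (k + 1)
    have h₄ := Nat.choose_succ_succ j k
    simp only [Nat.succ_eq_add_one] at h₃ h₄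
    omega

section

variable (F : Type*) [Field F]

theorem coeff_revDicksonFstPoly (n i : ℕ) :
    (revDicksonFstPoly F n).coeff i = (-1) ^ i * (dicksonCoeff n i : F) := by
  simp only [revDicksonFstPoly, finsetSum_coeff, coeff_C_mul_X_pow]
  rw [Finset.sum_ite_eq]
  split_ifs with h
  · rfl
  · rw [dicksonCoeff_eq_zero (by simp at h; omega)]
    simp

theorem revDicksonFstPoly_one : revDicksonFstPoly F 1 = 1 := by
  simp [revDicksonFstPoly, dicksonCoeff]

theorem revDicksonFstPoly_two : revDicksonFstPoly F 2 = 1 - 2 * X := by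
  simp [revDicksonFstPoly, dicksonCoeff, Finset.sum_range_succ]
  ring

theorem revDicksonFstPoly_four : revDicksonFstPoly F 4 = 1 - 4 * X + 2 * X ^ 2 := by
  simp [revDicksonFstPoly, dicksonCoeff, Finset.sum_range_succ]
  ring

theorem revDicksonFstPoly_add_two {n : ℕ} (hn : n ≠ 0) :
    revDicksonFstPoly F (n + 2) = revDicksonFstPoly F (n + 1) - X * revDicksonFstPoly F n := by
  ext (_ | i)
  · simp [coeff_revDicksonFstPoly, dicksonCoeff_zero]
  · simp only [coeff_sub, coeff_X_mul, coeff_revDicksonFstPoly, dicksonCoeff_add_two hn]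
    push_cast
    ring

/-- The companion matrix of `T ^ 2 - T + X`. -/
noncomputable def revDicksonMatrix : Matrix (Fin 2) (Fin 2) F[X] := !![1, -X; 1, 0]

theorem revDicksonMatrix_sq :
    revDicksonMatrix F ^ 2 = revDicksonMatrix F - (X : F[X]) • 1 := by
  ext i j : 2
  fin_cases i <;> fin_cases j <;> simp [revDicksonMatrix, pow_two, Matrix.mul_apply]
  ring

theorem trace_revDicksonMatrix_pow_succ (n : ℕ) :
    (revDicksonMatrix F ^ (n + 1)).trace = revDicksonFstPoly F (n + 1) := by
  induction n using Nat.twoStepInduction with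
  | zero => simp [revDicksonFstPoly_one, revDicksonMatrix, Matrix.trace_fin_two]
  | one =>
    rw [revDicksonFstPoly_two, revDicksonMatrix_sq]
    simp [revDicksonMatrix, Matrix.trace_fin_two]
    ring
  | more n ih₀ ih₁ =>
    rw [revDicksonFstPoly_add_two F n.succ_ne_zero, ← ih₀, ← ih₁,
      pow_add _ (n + 1) 2, revDicksonMatrix_sq, mul_sub, ← pow_succ]
    simp

theorem trace_pow_three_of_charP {R : Type*} [CommRing R] [CharP R 3]
    (A : Matrix (Fin 2) (Fin 2) R) : (A ^ 3).trace = A.trace ^ 3 := by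
  have h : (3 : R) = 0 := by exact_mod_cast CharP.cast_eq_zero R 3
  simp only [pow_three, Matrix.trace_fin_two, Matrix.mul_apply, Fin.sum_univ_two]
  linear_combination (A 0 0 + A 1 1) * (A 0 1 * A 1 0 - A 0 0 * A 1 1) * h

theorem revDicksonFstPoly_mul_three_pow [CharP F 3] {n : ℕ} (hn : n ≠ 0) (m : ℕ) :
    revDicksonFstPoly F (n * 3 ^ m) = revDicksonFstPoly F n ^ 3 ^ m := by
  induction m with
  | zero => simp
  | succ m ih =>
    have h₁ : n * 3 ^ m ≠ 0 := by positivity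
    obtain ⟨a, ha⟩ := Nat.exists_eq_succ_of_ne_zero h₁
    have h₂ : n * 3 ^ (m + 1) ≠ 0 := by positivity
    obtain ⟨b, hb⟩ := Nat.exists_eq_succ_of_ne_zero h₂
    rw [pow_succ 3 m, pow_mul, ← ih, ha, ← trace_revDicksonMatrix_pow_succ,
      ← trace_pow_three_of_charP, ← pow_mul, ← Nat.succ_eq_add_one, ← ha, mul_assoc, ← pow_succ,
      hb, Nat.succ_eq_add_one, trace_revDicksonMatrix_pow_succ]

theorem DD_eq_comp_sub_one {n : ℕ} (hn : n ≠ 0) (d : ℕ) :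
    DD F n d = (revDicksonFstPoly F n).comp (X ^ d) - 1 := by
  rw [DD, revDicksonFstPoly, Finset.range_eq_Ico, Finset.sum_eq_sum_Ico_succ_bot (by omega)]
  simp only [add_comp, Polynomial.sum_comp, mul_comp, C_comp, pow_comp, X_comp, ← pow_mul]
  rw [dicksonCoeff_zero hn]
  simp [← Finset.Ico_add_one_right_eq_Icc, pow_mul]

end

theorem stmt8 {F : Type*} [Field F] [Fintype F] (e : ℕ) (he : 0 < e)
    (hcard : Fintype.card F = 3 ^ e) (l m : ℕ) :
    DD F (4 * 3 ^ m) (2 * 3 ^ l) =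
        C (2 : F) * X ^ (2 * 3 ^ (l + m)) + C (2 : F) * X ^ (4 * 3 ^ (l + m)) ∧
      IsDOPoly 3 (DD F (4 * 3 ^ m) (2 * 3 ^ l)) := by
  have : Fact (Nat.Prime 3) := ⟨Nat.prime_three⟩
  have : CharP F 3 := charP_of_card_eq_prime_pow hcard
  have h₃ : (3 : F[X]) = 0 := by exact_mod_cast CharP.cast_eq_zero F[X] 3
  have h₄ : revDicksonFstPoly F 4 = 1 - X - X ^ 2 := by
    rw [revDicksonFstPoly_four]
    linear_combination (X ^ 2 - X) * h₃
  have key : DD F (4 * 3 ^ m) (2 * 3 ^ l) =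
      C (2 : F) * X ^ (2 * 3 ^ (l + m)) + C (2 : F) * X ^ (4 * 3 ^ (l + m)) := by
    rw [DD_eq_comp_sub_one F (by positivity), revDicksonFstPoly_mul_three_pow F four_ne_zero, h₄,
      sub_pow_char_pow, sub_pow_char_pow, one_pow]
    simp only [sub_comp, one_comp, pow_comp, X_comp, ← pow_mul, map_ofNat]
    rw [show 2 * 3 ^ l * 3 ^ m = 2 * 3 ^ (l + m) by ring,
      show 2 * 3 ^ l * (2 * 3 ^ m) = 4 * 3 ^ (l + m) by ring]
    linear_combination -(X ^ (2 * 3 ^ (l + m)) + X ^ (4 * 3 ^ (l + m))) * h₃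
  refine ⟨key, fun k hk => ?_⟩
  rw [key, mem_support_iff, coeff_add, coeff_C_mul_X_pow, coeff_C_mul_X_pow] at hk
  by_cases h₁ : k = 2 * 3 ^ (l + m)
  · exact ⟨l + m, l + m, by omega⟩
  by_cases h₂ : k = 4 * 3 ^ (l + m)
  · exact ⟨l + m, l + m + 1, by rw [pow_succ]; omega⟩
  simp [h₁, h₂] at hk
end

section
/- Let p > 3 be a prime, q a power of p, and let i, ℓ, m ≥ 0 be integers. For n = 2·p^m and d = (p^i + 1)·p^ℓ, one has 𝒟_{n,d} = (p − 2)·x^{d·p^m} in 𝔽_q[x] (where p − 2 denotes the reduction of the integer −2 into 𝔽_q); in particular 𝒟_{n,d} is a Dembowski–Ostrom polynomial. -/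
open Polynomial Finset

theorem mul_dicksonCoeff {n i : ℕ} (hi : 1 ≤ i) (hin : i < n) :
    i * dicksonCoeff n i = n * (n - i - 1).choose (i - 1) := by
  obtain ⟨k, rfl⟩ : ∃ k, i = k + 1 := ⟨i - 1, by omega⟩
  obtain ⟨M, rfl⟩ : ∃ M, n = M + 1 + (k + 1) := ⟨n - (k + 1) - 1, by omega⟩
  have h := Nat.add_one_mul_choose_eq M k
  have hcoeff : dicksonCoeff (M + 1 + (k + 1)) (k + 1) =
      (M + 1).choose (k + 1) + M.choose k := by
    rw [dicksonCoeff, Nat.add_sub_cancel]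
    refine Nat.div_eq_of_eq_mul_right M.succ_pos ?_
    linarith
  rw [hcoeff, Nat.add_sub_cancel, Nat.add_sub_cancel, Nat.add_sub_cancel]
  linarith

theorem Nat.Prime.dvd_dicksonCoeff_two_mul_pow {p m i : ℕ} (hp : p.Prime) (hi : 1 ≤ i)
    (him : i < p ^ m) : p ∣ dicksonCoeff (2 * p ^ m) i := by
  by_contra hdvd
  have hpow : p ^ m ∣ i * dicksonCoeff (2 * p ^ m) i := by
    rw [mul_dicksonCoeff hi (by omega), mul_comm 2, mul_assoc]
    exact dvd_mul_right _ _
  have hcop : (p ^ m).Coprime (dicksonCoeff (2 * p ^ m) i) :=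
    ((Nat.Prime.coprime_iff_not_dvd hp).2 hdvd).pow_left m
  exact absurd (Nat.le_of_dvd hi (hcop.dvd_of_dvd_mul_right hpow)) (by omega)

theorem dicksonCoeff_two_mul_self {i : ℕ} (hi : 0 < i) : dicksonCoeff (2 * i) i = 2 := by
  have hsub : 2 * i - i = i := by omega
  rw [dicksonCoeff, hsub, Nat.choose_self, mul_one, Nat.mul_div_cancel _ hi]

theorem DD_two_mul_prime_pow {F : Type*} [Field F] {p : ℕ} [CharP F p] (hp : p.Prime)
    (hodd : Odd p) (m d : ℕ) :
    DD F (2 * p ^ m) d = C ((-2 : ℤ) : F) * X ^ (d * p ^ m) := by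
  have hpos : 0 < p ^ m := pow_pos hp.pos m
  rw [DD, Nat.mul_div_cancel_left _ two_pos, Finset.sum_eq_single_of_mem (p ^ m)]
  · rw [dicksonCoeff_two_mul_self hpos, hodd.pow.neg_one_pow]
    norm_num
  · exact Finset.mem_Icc.2 ⟨hpos, le_rfl⟩
  · intro j hj hne
    obtain ⟨hj1, hjm⟩ := Finset.mem_Icc.1 hj
    rw [(CharP.cast_eq_zero_iff F p _).2
      (hp.dvd_dicksonCoeff_two_mul_pow hj1 (lt_of_le_of_ne hjm hne))]
    simp

theorem isDOPoly_C_mul_X_pow {F : Type*} [Field F] (p : ℕ) (c : F) (i j : ℕ) :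
    IsDOPoly p (C c * X ^ (p ^ i + p ^ j)) := fun _ hk =>
  ⟨i, j, Finset.mem_singleton.1 (support_C_mul_X_pow_subset _ c hk)⟩

theorem stmt11 {F : Type*} [Field F] [Fintype F] (p e : ℕ) (hp : p.Prime)
    (hp3 : 3 < p) (he : 0 < e) (hcard : Fintype.card F = p ^ e) (i l m : ℕ) :
    DD F (2 * p ^ m) ((p ^ i + 1) * p ^ l) =
        C ((-2 : ℤ) : F) * X ^ ((p ^ i + 1) * p ^ l * p ^ m) ∧
      IsDOPoly p (DD F (2 * p ^ m) ((p ^ i + 1) * p ^ l)) := by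
  have : Fact p.Prime := ⟨hp⟩
  have : CharP F p := charP_of_card_eq_prime_pow hcard
  have hDD := DD_two_mul_prime_pow (F := F) hp (hp.odd_of_ne_two (by omega)) m
    ((p ^ i + 1) * p ^ l)
  refine ⟨hDD, ?_⟩
  have hexp : (p ^ i + 1) * p ^ l * p ^ m = p ^ (i + l + m) + p ^ (l + m) := by ring
  rw [hDD, hexp]
  exact isDOPoly_C_mul_X_pow p _ _ _
end
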